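/- Let R be a commutative ring, r ≥ 1, and φ an r×(r−1) matrix over R. Define the R-linear map ψ : R^r → R by ψ(v) = det of the r×r matrix whose first r−1 columns are the columns of φ and whose last column is v. Then: (a) ψ(φ·w) = 0 for every w ∈ R^{r−1}, so R^{r−1} →(φ) R^r →(ψ) R is a complex; and (b) if there exists a choice of r−1 of the r rows of φ such that the determinant of the resulting (r−1)×(r−1) submatrix is a unit of R, then the sequence 0 → R^{r−1} →(φ) R^r →(ψ) R → 0 is exact (φ is injective, the kernel of ψ equals the image of φ, and ψ is surjective). -/

import Mathlib

/-- Given an `r × (r-1)` matrix `φ` over `R` and a vector `v : Fin r → R`, the determinant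
of the `r × r` matrix whose first `r - 1` columns are the columns of `φ` and whose last
column is `v`.  This is the (R-linear in `v`) last differential of the local model of the
dual Buchsbaum–Rim complex `0 → R^{r-1} → R^r → R → 0`. -/
noncomputable def borderDet {R : Type*} [CommRing R] (r : ℕ)
    (φ : Matrix (Fin r) (Fin (r - 1)) R) (v : Fin r → R) : R :=
  (Matrix.of fun i (j : Fin r) =>
    if h : (j : ℕ) < r - 1 then φ i ⟨j, h⟩ else v i).det

namespace Matrix

variable {R : Type*} {n : ℕ}

/-- The square matrix `[φ | v]` obtained by appending the column `v` to `φ`. -/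
def appendCol (φ : Matrix (Fin (n + 1)) (Fin n) R) (v : Fin (n + 1) → R) :
    Matrix (Fin (n + 1)) (Fin (n + 1)) R :=
  of fun i => Fin.snoc (φ i) (v i)

theorem updateCol_appendCol_last (φ : Matrix (Fin (n + 1)) (Fin n) R) (u v : Fin (n + 1) → R) :
    (φ.appendCol u).updateCol (Fin.last n) v = φ.appendCol v := by
  ext i j
  refine Fin.lastCases ?_ (fun j => ?_) j <;> simp [appendCol]

variable [CommRing R]

theorem appendCol_mulVec_snoc (φ : Matrix (Fin (n + 1)) (Fin n) R) (v : Fin (n + 1) → R)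
    (w : Fin n → R) (t : R) :
    φ.appendCol v *ᵥ Fin.snoc w t = φ *ᵥ w + t • v := by
  ext i
  simp [appendCol, mulVec, dotProduct, Fin.sum_univ_castSucc, mul_comm t]

theorem det_appendCol_mulVec_add_smul (φ : Matrix (Fin (n + 1)) (Fin n) R)
    (v : Fin (n + 1) → R) (w : Fin n → R) (t : R) :
    (φ.appendCol (φ *ᵥ w + t • v)).det = t * (φ.appendCol v).det := by
  rw [← updateCol_appendCol_last φ v, ← cramer_apply, cramer_eq_adjugate_mulVec,
    ← appendCol_mulVec_snoc, mulVec_mulVec, adjugate_mul, smul_mulVec, one_mulVec]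
  simp [mul_comm]

theorem det_appendCol_single (φ : Matrix (Fin (n + 1)) (Fin n) R) (i : Fin (n + 1)) :
    (φ.appendCol (Pi.single i 1)).det =
      (-1) ^ (i + n : ℕ) * (φ.submatrix i.succAbove id).det := by
  rw [det_succ_column _ (Fin.last n), Finset.sum_eq_single i]
  · have h : (φ.appendCol (Pi.single i 1)).submatrix i.succAbove (Fin.last n).succAbove =
        φ.submatrix i.succAbove id := by
      ext a b
      simp [appendCol]
    rw [h]
    simp [appendCol]
  · intro j _ hj
    simp [appendCol, hj]
  · simp

/-- A unit maximal minor of `φ` lets one complete `φ` to an invertible matrix. -/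
theorem exists_isUnit_det_appendCol (φ : Matrix (Fin (n + 1)) (Fin n) R)
    {ι : Fin n → Fin (n + 1)} (hι : Function.Injective ι)
    (hu : IsUnit (φ.submatrix ι id).det) :
    ∃ v, IsUnit (φ.appendCol v).det := by
  obtain ⟨i, hi⟩ : ∃ i, ∀ k, ι k ≠ i := by
    by_contra! h
    simpa using Fintype.card_le_of_surjective ι h
  choose σ hσ using fun k => Fin.exists_succAbove_eq (hi k)
  have hσ_inj : Function.Injective σ := fun a b hab => hι (by rw [← hσ a, ← hσ b, hab])
  let e : Equiv.Perm (Fin n) := Equiv.ofBijective σ (Finite.injective_iff_bijective.mp hσ_inj)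
  have h : φ.submatrix ι id = (φ.submatrix i.succAbove id).submatrix e id := by
    ext a b
    simp [e, hσ]
  rw [h, det_permute] at hu
  refine ⟨Pi.single i 1, ?_⟩
  rw [det_appendCol_single]
  exact (isUnit_one.neg.pow _).mul (isUnit_of_mul_isUnit_right hu)

end Matrix

theorem borderDet_succ {R : Type*} [CommRing R] {n : ℕ} (φ : Matrix (Fin (n + 1)) (Fin n) R)
    (v : Fin (n + 1) → R) : borderDet (n + 1) φ v = (φ.appendCol v).det := by
  unfold borderDet
  congr 1

/-- (a) The composition `R^{r-1} → R^r → R`, where the first map is `w ↦ φ ⬝ w` and the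
second is `v ↦ det [φ | v]`, is zero, so we have a complex; and
(b) if some `(r-1) × (r-1)` submatrix of `φ` formed by `r - 1` of its rows has unit
determinant, then the complex `0 → R^{r-1} → R^r → R → 0` is exact: `φ` is injective, the
kernel of `ψ = det [φ | ·]` is the image of `φ`, and `ψ` is surjective. -/
theorem buchsbaumRim_complex_and_exact (R : Type*) [CommRing R] (r : ℕ) (hr : 1 ≤ r)
    (φ : Matrix (Fin r) (Fin (r - 1)) R) :
    (∀ w : Fin (r - 1) → R, borderDet r φ (φ.mulVec w) = 0) ∧
    ((∃ ι : Fin (r - 1) → Fin r, Function.Injective ι ∧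
        IsUnit (φ.submatrix ι id).det) →
      Function.Injective φ.mulVec ∧
      (∀ v : Fin r → R, borderDet r φ v = 0 ↔ ∃ w, φ.mulVec w = v) ∧
      Function.Surjective (borderDet r φ)) := by
  obtain ⟨n, rfl⟩ : ∃ n, r = n + 1 := ⟨r - 1, by omega⟩
  change Matrix (Fin (n + 1)) (Fin n) R at φ
  have hψ (v : Fin (n + 1) → R) (w : Fin n → R) (t : R) :
      borderDet (n + 1) φ (φ.mulVec w + t • v) = t * (φ.appendCol v).det := by
    rw [borderDet_succ, Matrix.det_appendCol_mulVec_add_smul]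
  have hcomplex (w : Fin n → R) : borderDet (n + 1) φ (φ.mulVec w) = 0 := by
    simpa using hψ 0 w 0
  refine ⟨hcomplex, ?_⟩
  rintro ⟨ι, hι, hu⟩
  obtain ⟨v₀, hv₀⟩ := φ.exists_isUnit_det_appendCol hι hu
  have hM : IsUnit (φ.appendCol v₀) := (Matrix.isUnit_iff_isUnit_det _).mpr hv₀
  refine ⟨fun w w' h => ?_, fun v => ⟨fun hv => ?_, ?_⟩, fun c => ?_⟩
  · have h' : (φ.appendCol v₀).mulVec (Fin.snoc w 0 : Fin (n + 1) → R) =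
        (φ.appendCol v₀).mulVec (Fin.snoc w' 0 : Fin (n + 1) → R) := by
      simpa only [Matrix.appendCol_mulVec_snoc, zero_smul, add_zero] using h
    exact (Fin.snoc_inj.mp (Matrix.mulVec_injective_of_isUnit hM h')).1
  · obtain ⟨x, rfl⟩ := Matrix.mulVec_surjective_iff_isUnit.mpr hM v
    obtain ⟨w, t, rfl⟩ : ∃ (w : Fin n → R) (t : R), x = Fin.snoc w t :=
      ⟨Fin.init x, x (Fin.last n), (Fin.snoc_init_self x).symm⟩
    rw [Matrix.appendCol_mulVec_snoc] at hv ⊢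
    rw [hψ, hv₀.mul_left_eq_zero] at hv
    exact ⟨w, by simp [hv]⟩
  · rintro ⟨w, rfl⟩
    exact hcomplex w
  · obtain ⟨d, hd⟩ := hv₀.exists_left_inv
    refine ⟨φ.mulVec 0 + (c * d) • v₀, ?_⟩
    rw [hψ, mul_assoc, hd, mul_one]
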